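/- If X is a homogeneous compactum, then |X| ≤ 2^{wt(X)·πχ(X)}. -/

import Mathlib

open Cardinal Set Topology
universe u
noncomputable section

/-- The tightness of a space: the least infinite cardinal `τ` such that whenever
`y ∈ closure A` there is `B ⊆ A` with `#B ≤ τ` and `y ∈ closure B`. -/
def tightness (Y : Type u) [TopologicalSpace Y] : Cardinal.{u} :=
  sInf {τ : Cardinal.{u} | ℵ₀ ≤ τ ∧ ∀ (A : Set Y) (y : Y), y ∈ closure A →
    ∃ B ⊆ A, #B ≤ τ ∧ y ∈ closure B}

/-- The `μ`-closure of a set `A`: the union of the closures of all subsets of `A`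
of cardinality at most `μ`. -/
def kClosure {X : Type u} [TopologicalSpace X] (μ : Cardinal.{u}) (A : Set X) : Set X :=
  ⋃ B ∈ {B : Set X | B ⊆ A ∧ #B ≤ μ}, closure B

/-- `𝒞` witnesses that the weak tightness of `X` is at most `κ`. -/
def IsWeakTightnessWitness (X : Type u) [TopologicalSpace X] (κ : Cardinal.{u})
    (𝒞 : Set (Set X)) : Prop :=
  ⋃₀ 𝒞 = Set.univ ∧ #𝒞 ≤ 2 ^ κ ∧ ∀ C ∈ 𝒞, tightness C ≤ κ ∧ kClosure (2 ^ κ) C = Set.univ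

/-- The weak tightness of `X`: the least infinite cardinal `κ` for which there is a
cover `𝒞` of `X` with `#𝒞 ≤ 2^κ` such that each `C ∈ 𝒞` has tightness at most `κ`
and `X = cl_{2^κ} C`. -/
def weakTightness (X : Type u) [TopologicalSpace X] : Cardinal.{u} :=
  sInf {κ : Cardinal.{u} | ℵ₀ ≤ κ ∧ ∃ 𝒞 : Set (Set X), IsWeakTightnessWitness X κ 𝒞}

/-- The π-character of a point `x`: the least cardinality of a family of nonempty
open sets such that every neighborhood of `x` contains a member of the family. -/
def piCharacterAt {X : Type u} [TopologicalSpace X] (x : X) : Cardinal.{u} :=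
  sInf {c : Cardinal.{u} | ∃ 𝒰 : Set (Set X), #𝒰 = c ∧
    (∀ U ∈ 𝒰, IsOpen U ∧ U.Nonempty) ∧ ∀ N ∈ nhds x, ∃ U ∈ 𝒰, U ⊆ N}

/-- The π-character of a space: the supremum of the π-characters at its points
(at least `ℵ₀`). -/
def piCharacter (X : Type u) [TopologicalSpace X] : Cardinal.{u} :=
  max ℵ₀ (⨆ x : X, piCharacterAt x)

/-- The Lindelöf degree: the least infinite cardinal `κ` such that every open cover
has a subcover of cardinality at most `κ`. -/
def lindelofDegree (X : Type u) [TopologicalSpace X] : Cardinal.{u} :=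
  sInf {κ : Cardinal.{u} | ℵ₀ ≤ κ ∧ ∀ 𝒰 : Set (Set X), (∀ U ∈ 𝒰, IsOpen U) →
    ⋃₀ 𝒰 = Set.univ → ∃ 𝒱 ⊆ 𝒰, #𝒱 ≤ κ ∧ ⋃₀ 𝒱 = Set.univ}

/-- The density of `X`: the least infinite cardinality of a dense subset. -/
def density (X : Type u) [TopologicalSpace X] : Cardinal.{u} :=
  sInf {c : Cardinal.{u} | ℵ₀ ≤ c ∧ ∃ D : Set X, Dense D ∧ #D ≤ c}

/-- The pseudocharacter of a subset `F` of `X`: the least infinite cardinality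
of a family of open sets whose intersection is `F`. -/
def setPseudoCharacter {X : Type u} [TopologicalSpace X] (F : Set X) : Cardinal.{u} :=
  sInf {κ : Cardinal.{u} | ℵ₀ ≤ κ ∧ ∃ 𝒰 : Set (Set X), #𝒰 ≤ κ ∧
    (∀ U ∈ 𝒰, IsOpen U) ∧ ⋂₀ 𝒰 = F}

/-- The pseudocharacter of a space: the least infinite `κ` such that every singleton
is the intersection of at most `κ` open sets. -/
def pseudoCharacter (X : Type u) [TopologicalSpace X] : Cardinal.{u} :=
  sInf {κ : Cardinal.{u} | ℵ₀ ≤ κ ∧ ∀ x : X, ∃ 𝒰 : Set (Set X), #𝒰 ≤ κ ∧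
    (∀ U ∈ 𝒰, IsOpen U) ∧ ⋂₀ 𝒰 = {x}}

/-- The character of a (closed) set `G` in `X`: the least infinite cardinality of a
family `𝒰` of open sets containing `G` such that every open set containing `G`
contains a member of `𝒰`. -/
def setCharacter {X : Type u} [TopologicalSpace X] (G : Set X) : Cardinal.{u} :=
  sInf {κ : Cardinal.{u} | ℵ₀ ≤ κ ∧ ∃ 𝒰 : Set (Set X), #𝒰 ≤ κ ∧
    (∀ U ∈ 𝒰, IsOpen U ∧ G ⊆ U) ∧ ∀ V : Set X, IsOpen V → G ⊆ V → ∃ U ∈ 𝒰, U ⊆ V}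

/-- A cardinal `λ` is a caliber of `X` if every `λ`-indexed family of nonempty open
sets has a subfamily of cardinality `λ` with nonempty intersection. -/
def IsCaliber (X : Type u) [TopologicalSpace X] (lam : Cardinal.{u}) : Prop :=
  ∀ (ι : Type u) (U : ι → Set X), #ι = lam → (∀ i, IsOpen (U i) ∧ (U i).Nonempty) →
    ∃ J : Set ι, #J = lam ∧ (⋂ i ∈ J, U i).Nonempty

/-- A space is quasiregular if every nonempty open set contains the closure of a
nonempty open set. -/
def Quasiregular (X : Type u) [TopologicalSpace X] : Prop :=
  ∀ U : Set X, IsOpen U → U.Nonempty → ∃ V : Set X, IsOpen V ∧ V.Nonempty ∧ closure V ⊆ U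

/-- The θ-closure of a set `A`. -/
def thetaClosure {X : Type u} [TopologicalSpace X] (A : Set X) : Set X :=
  {x : X | ∀ U : Set X, IsOpen U → x ∈ U → (closure U ∩ A).Nonempty}

/-- The θ-density of `X`: the least infinite cardinality of a θ-dense subset. -/
def thetaDensity (X : Type u) [TopologicalSpace X] : Cardinal.{u} :=
  sInf {c : Cardinal.{u} | ℵ₀ ≤ c ∧ ∃ D : Set X, thetaClosure D = Set.univ ∧ #D ≤ c}

/-- The linear Lindelöf degree: the least infinite cardinal `κ` such that every open
cover totally ordered by inclusion has a subcover of cardinality at most `κ`. -/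
def linearLindelofDegree (X : Type u) [TopologicalSpace X] : Cardinal.{u} :=
  sInf {κ : Cardinal.{u} | ℵ₀ ≤ κ ∧ ∀ 𝒰 : Set (Set X), (∀ U ∈ 𝒰, IsOpen U) →
    IsChain (· ⊆ ·) 𝒰 → ⋃₀ 𝒰 = Set.univ → ∃ 𝒱 ⊆ 𝒰, #𝒱 ≤ κ ∧ ⋃₀ 𝒱 = Set.univ}

/-- The almost Lindelöf degree with respect to closed sets. -/
def almostLindelofDegreeClosed (X : Type u) [TopologicalSpace X] : Cardinal.{u} :=
  sInf {κ : Cardinal.{u} | ℵ₀ ≤ κ ∧ ∀ (F : Set X) (𝒱 : Set (Set X)), IsClosed F →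
    (∀ V ∈ 𝒱, IsOpen V) → F ⊆ ⋃₀ 𝒱 →
    ∃ 𝒱' ⊆ 𝒱, #𝒱' ≤ κ ∧ F ⊆ ⋃ V ∈ 𝒱', closure V}

/-- The closed pseudocharacter of a space. -/
def closedPseudoCharacter (X : Type u) [TopologicalSpace X] : Cardinal.{u} :=
  sInf {κ : Cardinal.{u} | ℵ₀ ≤ κ ∧ ∀ x : X, ∃ 𝒰 : Set (Set X), #𝒰 ≤ κ ∧
    (∀ U ∈ 𝒰, IsOpen U ∧ x ∈ U) ∧ ⋂ U ∈ 𝒰, closure U = {x}}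

/-- `𝒞`-saturated sets: `A ∩ C` is dense in `A` for every `C ∈ 𝒞`. -/
def IsSaturated {X : Type u} [TopologicalSpace X] (𝒞 : Set (Set X)) (A : Set X) : Prop :=
  ∀ C ∈ 𝒞, A ⊆ closure (A ∩ C)

/-- The closed `G_κ`-sets: intersections of at most `κ` open sets, which are also the
intersection of the closures of these open sets. -/
def IsClosedGKappa {X : Type u} [TopologicalSpace X] (κ : Cardinal.{u}) (G : Set X) : Prop :=
  ∃ (ι : Type u) (U : ι → Set X), #ι ≤ κ ∧ (∀ i, IsOpen (U i)) ∧ (∀ i, G ⊆ U i) ∧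
    ⋂ i, closure (U i) ⊆ G

theorem mk_iUnion_le_of_le {ι X : Type u} {c : Cardinal.{u}} (hc : ℵ₀ ≤ c) (f : ι → Set X)
    (hι : #ι ≤ c) (hf : ∀ i, #(f i) ≤ c) : #(⋃ i, f i : Set X) ≤ c :=
  (mk_iUnion_le f).trans (Cardinal.mul_le_of_le hc hι (ciSup_le' hf))

theorem two_power_power_self {κ : Cardinal.{u}} (hκ : ℵ₀ ≤ κ) :
    ((2 : Cardinal.{u}) ^ κ) ^ κ = 2 ^ κ := by
  rw [← power_mul, Cardinal.mul_eq_self hκ]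

theorem aleph0_le_two_power {κ : Cardinal.{u}} (hκ : ℵ₀ ≤ κ) : ℵ₀ ≤ (2 : Cardinal.{u}) ^ κ :=
  hκ.trans (cantor κ).le

theorem mk_bounded_subset_le_two_power {X : Type u} {κ : Cardinal.{u}} (hκ : ℵ₀ ≤ κ) {A : Set X}
    (hA : #A ≤ 2 ^ κ) : #{B : Set X // B ⊆ A ∧ #B ≤ κ} ≤ 2 ^ κ := by
  refine (mk_bounded_subset_le A κ).trans ?_
  refine (power_le_power_right (max_le hA (aleph0_le_two_power hκ))).trans ?_
  rw [two_power_power_self hκ]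

/-- Closing off under an operation on subsets of size at most `κ` with values of size at
most `2 ^ κ`. -/
theorem exists_closed_under_operation {X : Type u} [Nonempty X] {κ : Cardinal.{u}} (hκ : ℵ₀ ≤ κ)
    (Φ : Set X → Set X) (hΦ : ∀ B : Set X, #B ≤ κ → #(Φ B) ≤ 2 ^ κ) :
    ∃ A : Set X, #A ≤ 2 ^ κ ∧ ∀ B ⊆ A, #B ≤ κ → Φ B ⊆ A := by
  have key : ∀ B : Set X, ∃ e : ((2 : Cardinal.{u}) ^ κ).out → X, #B ≤ κ → Φ B ⊆ range e := by
    intro B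
    by_cases hB : #B ≤ κ
    · have h := hΦ B hB
      rw [← mk_out ((2 : Cardinal.{u}) ^ κ)] at h
      obtain ⟨f⟩ := h
      obtain ⟨x₀⟩ := ‹Nonempty X›
      refine ⟨Function.extend f Subtype.val fun _ => x₀, fun _ b hb => ⟨f ⟨b, hb⟩, ?_⟩⟩
      rw [f.injective.extend_apply]
    · exact ⟨fun _ => Classical.arbitrary X, fun h => absurd h hB⟩
  choose e he using key
  let W := WType fun a : ((2 : Cardinal.{u}) ^ κ).out × Set κ.out => ↥a.2
  let ev : W → X := WType.elim X fun p => e (range p.2) p.1.1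
  have hW : #W ≤ 2 ^ κ := by
    refine WType.cardinalMk_le_of_le ?_
    refine (sum_le_mk_mul_iSup _).trans (Cardinal.mul_le_of_le (aleph0_le_two_power hκ) ?_ ?_)
    · rw [mk_prod, lift_id, lift_id, mk_out, mk_set, mk_out,
        Cardinal.mul_eq_self (aleph0_le_two_power hκ)]
    · refine ciSup_le' fun a => ?_
      refine (power_le_power_left (aleph0_pos.trans_le (aleph0_le_two_power hκ)).ne' (mk_set_le a.2)).trans ?_
      rw [mk_out, two_power_power_self hκ]
  refine ⟨range ev, mk_range_le.trans hW, fun B hBA hB => ?_⟩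
  have hB' := hB
  rw [← mk_out κ] at hB'
  obtain ⟨f⟩ := hB'
  choose w hw using fun b : B => hBA b.2
  intro x hx
  obtain ⟨t, ht⟩ := he B hB hx
  let q : range f ≃ B := (Equiv.ofInjective f f.injective).symm
  refine ⟨WType.mk (t, range f) fun s => w (q s), ?_⟩
  have hr : (range fun s => ev (w (q s))) = B := by
    ext b
    constructor
    · rintro ⟨s, rfl⟩
      simp only [hw]
      exact (q s).2
    · intro hb
      exact ⟨q.symm ⟨b, hb⟩, by simp [hw]⟩
  change e (range fun s => ev (w (q s))) t = x
  rw [hr, ht]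

theorem exists_subset_mem_closure_of_tightness_le {Y : Type u} [TopologicalSpace Y]
    {κ : Cardinal.{u}} (h : tightness Y ≤ κ) {A : Set Y} {y : Y} (hy : y ∈ closure A) :
    ∃ B ⊆ A, #B ≤ κ ∧ y ∈ closure B := by
  have hne : {τ : Cardinal.{u} | ℵ₀ ≤ τ ∧ ∀ (A : Set Y) (y : Y), y ∈ closure A →
      ∃ B ⊆ A, #B ≤ τ ∧ y ∈ closure B}.Nonempty :=
    ⟨max ℵ₀ #Y, le_max_left _ _, fun A y hy =>
      ⟨A, Subset.rfl, (mk_set_le A).trans (le_max_right _ _), hy⟩⟩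
  obtain ⟨B, hBA, hB, hyB⟩ := (csInf_mem hne).2 A y hy
  exact ⟨B, hBA, hB.trans h, hyB⟩

theorem isWeakTightnessWitness_weakTightness (X : Type u) [TopologicalSpace X] :
    ℵ₀ ≤ weakTightness X ∧ ∃ 𝒞 : Set (Set X), IsWeakTightnessWitness X (weakTightness X) 𝒞 := by
  have hne : {κ : Cardinal.{u} | ℵ₀ ≤ κ ∧
      ∃ 𝒞 : Set (Set X), IsWeakTightnessWitness X κ 𝒞}.Nonempty := by
    refine ⟨max (tightness (Set.univ : Set X)) (max ℵ₀ #X),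
      (le_max_left _ _).trans (le_max_right _ _), {Set.univ}, by simp, ?_, ?_⟩
    · rw [mk_singleton]
      exact one_le_two.trans
        (self_le_power 2 (one_le_aleph0.trans ((le_max_left _ _).trans (le_max_right _ _))))
    · rintro C rfl
      refine ⟨le_max_left _ _, eq_univ_of_forall fun x => ?_⟩
      refine mem_biUnion (x := Set.univ) ⟨Subset.rfl, ?_⟩ (subset_closure (mem_univ x))
      rw [mk_univ]
      exact ((le_max_right _ _).trans (le_max_right _ _)).trans (cantor _).le
  exact csInf_mem hne

theorem IsWeakTightnessWitness.mono {X : Type u} [TopologicalSpace X] {κ μ : Cardinal.{u}}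
    {𝒞 : Set (Set X)} (h : IsWeakTightnessWitness X κ 𝒞) (hκμ : κ ≤ μ) :
    IsWeakTightnessWitness X μ 𝒞 := by
  have h2 : (2 : Cardinal.{u}) ^ κ ≤ 2 ^ μ := power_le_power_left two_ne_zero hκμ
  refine ⟨h.1, h.2.1.trans h2, fun C hC => ⟨(h.2.2 C hC).1.trans hκμ, ?_⟩⟩
  refine eq_univ_of_univ_subset ((h.2.2 C hC).2.symm.subset.trans ?_)
  exact biUnion_mono (fun B hB => ⟨hB.1, hB.2.trans h2⟩) fun _ _ => Subset.rfl

theorem IsSaturated.iUnion {X : Type u} [TopologicalSpace X] {𝒞 : Set (Set X)} {ι : Sort*}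
    {A : ι → Set X} (h : ∀ i, IsSaturated 𝒞 (A i)) : IsSaturated 𝒞 (⋃ i, A i) := fun C hC =>
  iUnion_subset fun i => (h i C hC).trans
    (closure_mono (inter_subset_inter_left _ (subset_iUnion A i)))

/-- The closure of a saturated set is its `κ`-closure. -/
theorem IsSaturated.exists_subset_mem_closure {X : Type u} [TopologicalSpace X]
    {κ : Cardinal.{u}} {𝒞 : Set (Set X)} (h𝒞 : IsWeakTightnessWitness X κ 𝒞) {A : Set X}
    (hA : IsSaturated 𝒞 A) {y : X} (hy : y ∈ closure A) :
    ∃ B ⊆ A, #B ≤ κ ∧ y ∈ closure B := by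
  obtain ⟨C, hC, hyC⟩ : y ∈ ⋃₀ 𝒞 := h𝒞.1 ▸ mem_univ y
  have hy' : y ∈ closure (A ∩ C) := closure_minimal (hA C hC) isClosed_closure hy
  have hyA : (⟨y, hyC⟩ : C) ∈ closure ((↑) ⁻¹' A : Set C) := by
    rw [closure_subtype, Subtype.image_preimage_coe, inter_comm]
    exact hy'
  obtain ⟨B, hBA, hB, hyB⟩ := exists_subset_mem_closure_of_tightness_le (h𝒞.2.2 C hC).1 hyA
  refine ⟨(↑) '' B, image_subset_iff.2 hBA, mk_image_le.trans hB, ?_⟩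
  rwa [closure_subtype] at hyB

/-- Any operation of the appropriate size can be closed off by a saturated set. -/
theorem exists_isSaturated_closed_under {X : Type u} [TopologicalSpace X] [Nonempty X]
    {κ : Cardinal.{u}} (hκ : ℵ₀ ≤ κ) {𝒞 : Set (Set X)} (h𝒞 : IsWeakTightnessWitness X κ 𝒞)
    (Φ : Set X → Set X) (hΦ : ∀ B : Set X, #B ≤ κ → #(Φ B) ≤ 2 ^ κ) :
    ∃ A : Set X, #A ≤ 2 ^ κ ∧ IsSaturated 𝒞 A ∧ ∀ B ⊆ A, #B ≤ κ → Φ B ⊆ A := by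
  have h2 := aleph0_le_two_power hκ
  have key : ∀ (x : X) (C : 𝒞), ∃ P : Set X, P ⊆ C ∧ #P ≤ 2 ^ κ ∧ x ∈ closure P := by
    intro x C
    have hx : x ∈ kClosure (2 ^ κ) (C : Set X) := (h𝒞.2.2 C C.2).2 ▸ mem_univ x
    simpa [kClosure, and_assoc] using hx
  choose P hPC hP hxP using key
  obtain ⟨A, hA, hA'⟩ := exists_closed_under_operation hκ
    (fun B => (⋃ b : B, ⋃ C : 𝒞, P b C) ∪ Φ B) fun B hB =>
      (mk_union_le _ _).trans (add_le_of_le h2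
        (mk_iUnion_le_of_le h2 _ (hB.trans (cantor κ).le) fun b =>
          mk_iUnion_le_of_le h2 _ h𝒞.2.1 fun C => hP b C) (hΦ B hB))
  refine ⟨A, hA, fun C hC x hx => ?_, fun B hBA hB => subset_union_right.trans (hA' B hBA hB)⟩
  refine closure_mono (subset_inter ?_ (hPC x ⟨C, hC⟩)) (hxP x ⟨C, hC⟩)
  have hsub := hA' {x} (singleton_subset_iff.2 hx)
    (by rw [mk_singleton]; exact one_le_aleph0.trans hκ)
  refine Subset.trans (fun z hz => Or.inl ?_) hsub
  exact mem_iUnion.2 ⟨⟨x, rfl⟩, mem_iUnion.2 ⟨⟨C, hC⟩, hz⟩⟩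

namespace IsClosedGKappa

variable {X : Type u} [TopologicalSpace X] {κ : Cardinal.{u}}

theorem isClosed {G : Set X} (hG : IsClosedGKappa κ G) : IsClosed G := by
  obtain ⟨ι, U, -, -, hGU, hUG⟩ := hG
  rw [(subset_iInter fun i => (hGU i).trans subset_closure).antisymm hUG]
  exact isClosed_iInter fun _ => isClosed_closure

theorem iInter (hκ : ℵ₀ ≤ κ) {ι : Type u} (hι : #ι ≤ κ) {G : ι → Set X}
    (hG : ∀ i, IsClosedGKappa κ (G i)) : IsClosedGKappa κ (⋂ i, G i) := by
  choose J U hJ hU hGU hUG using hG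
  refine ⟨Σ i, J i, fun p => U p.1 p.2, ?_, fun p => hU p.1 p.2,
    fun p => (iInter_subset G p.1).trans (hGU p.1 p.2), ?_⟩
  · rw [mk_sigma]
    exact (sum_le_mk_mul_iSup _).trans (Cardinal.mul_le_of_le hκ hι (ciSup_le' hJ))
  · refine subset_iInter fun i => Subset.trans (subset_iInter fun j => ?_) (hUG i)
    exact iInter_subset (fun p : Σ i, J i => closure (U p.1 p.2)) ⟨i, j⟩

theorem inter (hκ : ℵ₀ ≤ κ) {G H : Set X} (hG : IsClosedGKappa κ G) (hH : IsClosedGKappa κ H) :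
    IsClosedGKappa κ (G ∩ H) := by
  obtain ⟨ι, U, hι, hU, hGU, hUG⟩ := hG
  obtain ⟨J, V, hJ, hV, hHV, hVH⟩ := hH
  refine ⟨ι ⊕ J, Sum.elim U V, ?_, ?_, ?_, ?_⟩
  · rw [mk_sum, lift_id, lift_id]
    exact add_le_of_le hκ hι hJ
  · rintro (i | j)
    exacts [hU i, hV j]
  · rintro (i | j)
    exacts [inter_subset_left.trans (hGU i), inter_subset_right.trans (hHV j)]
  · rw [iInter_sum]
    exact inter_subset_inter hUG hVH

end IsClosedGKappa

theorem exists_isClosedGKappa_disjoint {X : Type u} [TopologicalSpace X] [CompactSpace X]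
    [T2Space X] {κ : Cardinal.{u}} (hκ : ℵ₀ ≤ κ) {K : Set X} (hK : IsClosed K) {x : X}
    (hx : x ∉ K) : ∃ E : Set X, IsClosedGKappa κ E ∧ x ∈ E ∧ Disjoint E K := by
  obtain ⟨f, hf0, hf1, -⟩ := exists_continuous_zero_one_of_isClosed (isClosed_singleton (x := x))
    hK (disjoint_singleton_left.2 hx)
  have hfc : Continuous f := f.continuous
  refine ⟨f ⁻¹' Iic 0, ⟨ULift ℕ, fun n => f ⁻¹' Iio (1 / ((n.down : ℝ) + 1)), by simpa using hκ,
    fun n => isOpen_Iio.preimage hfc, fun n => preimage_mono fun t ht => ?_, fun z hz => ?_⟩,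
    ?_, ?_⟩
  · exact lt_of_le_of_lt (mem_Iic.1 ht) Nat.one_div_pos_of_nat
  · refine mem_Iic.2 (ge_of_tendsto' (tendsto_one_div_add_atTop_nhds_zero_nat (𝕜 := ℝ)) fun n => ?_)
    have hz' := mem_iInter.1 hz ⟨n⟩
    exact closure_minimal (preimage_mono Iio_subset_Iic_self) (isClosed_Iic.preimage hfc) hz'
  · exact (hf0 rfl).le
  · refine disjoint_left.2 fun z hz hzK => ?_
    have h1 : f z = 1 := hf1 hzK
    have h0 : f z ≤ 0 := hz
    linarith

/-- A family of at most `κ` indices below the successor cardinal is bounded. -/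
theorem exists_forall_lt_of_mk_le {κ : Cardinal.{u}} (hκ : ℵ₀ ≤ κ)
    (s : Set (Order.succ κ).ord.ToType) (hs : #s ≤ κ) : ∃ a, ∀ b ∈ s, b < a := by
  by_contra! h
  have hc : Order.cof (Order.succ κ).ord.ToType ≤ #s := Order.cof_le h
  rw [Ordinal.cof_toType, (isRegular_succ hκ).cof_ord] at hc
  exact (Order.lt_succ κ).not_ge (hc.trans hs)

/-- In a compactum of weak tightness at most `κ`, some nonempty closed `G_κ`-set lies in the
closure of a set of size at most `2 ^ κ`. -/
theorem exists_isClosedGKappa_subset_closure {X : Type u} [TopologicalSpace X] [CompactSpace X]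
    [T2Space X] [Nonempty X] {κ : Cardinal.{u}} (hκ : ℵ₀ ≤ κ) {𝒞 : Set (Set X)}
    (h𝒞 : IsWeakTightnessWitness X κ 𝒞) :
    ∃ G H : Set X, IsClosedGKappa κ G ∧ G.Nonempty ∧ #H ≤ 2 ^ κ ∧ G ⊆ closure H := by
  by_contra! hcon
  have h2 := aleph0_le_two_power hκ
  have hsat : ∀ x : X, ∃ A : Set X, #A ≤ 2 ^ κ ∧ IsSaturated 𝒞 A ∧ x ∈ A := by
    intro x
    obtain ⟨A, hA, hAs, hAx⟩ := exists_isSaturated_closed_under hκ h𝒞 (fun _ => {x})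
      fun _ _ => by rw [mk_singleton]; exact one_le_aleph0.trans h2
    exact ⟨A, hA, hAs, hAx ∅ (empty_subset _) (by simp) rfl⟩
  choose sat hsat hsatS hmem using hsat
  have hstep : ∀ F A : Set X, ∃ p : X × Set X, IsClosedGKappa κ F → F.Nonempty → #A ≤ 2 ^ κ →
      p.1 ∈ p.2 ∧ p.2 ⊆ F ∧ IsClosedGKappa κ p.2 ∧ Disjoint p.2 (closure A) := by
    intro F A
    by_cases h : IsClosedGKappa κ F ∧ F.Nonempty ∧ #A ≤ 2 ^ κ
    · obtain ⟨hF, hFne, hA⟩ := h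
      obtain ⟨x, hxF, hxA⟩ := not_subset.1 (hcon F A hF hFne hA)
      obtain ⟨E, hE, hxE, hEA⟩ := exists_isClosedGKappa_disjoint hκ isClosed_closure hxA
      exact ⟨(x, F ∩ E), fun _ _ _ => ⟨⟨hxF, hxE⟩, inter_subset_left, hF.inter hκ hE,
        hEA.mono_left inter_subset_right⟩⟩
    · exact ⟨(Classical.arbitrary X, ∅), fun h₁ h₂ h₃ => absurd ⟨h₁, h₂, h₃⟩ h⟩
  choose g hg using hstep
  let I := (Order.succ κ).ord.ToType
  let p : I → X × Set X := WellFoundedLT.fix fun a q =>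
    g (⋂ b : Iio a, (q b b.2).2) (⋃ b : Iio a, sat (q b b.2).1)
  have hp : ∀ a, p a = g (⋂ b : Iio a, (p b).2) (⋃ b : Iio a, sat (p b).1) := fun a =>
    WellFoundedLT.fix_eq _ a
  have hIio : ∀ a : I, #(Iio a) ≤ κ := fun a => Order.lt_succ_iff.1 ((Cardinal.mk_Iio_lt a (by simp [I])).trans_eq (by simp [I]))
  have hprop : ∀ a, (p a).1 ∈ (p a).2 ∧ (∀ b < a, (p a).2 ⊆ (p b).2) ∧
      IsClosedGKappa κ (p a).2 ∧ Disjoint (p a).2 (closure (⋃ b : Iio a, sat (p b).1)) := by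
    intro a
    induction a using WellFoundedLT.induction with
    | ind a ih =>
    have hne : (⋂ b : Iio a, (p b).2).Nonempty := by
      rcases isEmpty_or_nonempty (Iio a) with he | he
      · simp
      refine IsCompact.nonempty_iInter_of_directed_nonempty_isCompact_isClosed _ ?_
        (fun b => ⟨_, (ih b b.2).1⟩) (fun b => (ih b b.2).2.2.1.isClosed.isCompact)
        fun b => (ih b b.2).2.2.1.isClosed
      refine Antitone.directed_ge fun b c hbc => ?_
      rcases hbc.eq_or_lt with rfl | hlt
      · exact Subset.rfl
      · exact (ih c c.2).2.1 b hlt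
    obtain ⟨h₁, h₂, h₃, h₄⟩ := hg _ _ (IsClosedGKappa.iInter hκ (hIio a)
      fun b => (ih b b.2).2.2.1) hne (mk_iUnion_le_of_le h2 _ ((hIio a).trans (cantor κ).le)
      fun b => hsat (p b).1)
    rw [← hp a] at h₁ h₂ h₃ h₄
    exact ⟨h₁, fun b hb => h₂.trans (iInter_subset (fun b : Iio a => (p b).2) ⟨b, hb⟩), h₃, h₄⟩
  have hanti : Antitone fun a => (p a).2 ∩ closure (⋃ b, sat (p b).1) := by
    intro b c hbc
    rcases hbc.eq_or_lt with rfl | hlt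
    · exact Subset.rfl
    · exact inter_subset_inter_left _ ((hprop c).2.1 b hlt)
  have hclosed : ∀ a, IsClosed ((p a).2 ∩ closure (⋃ b, sat (p b).1)) := fun a =>
    (hprop a).2.2.1.isClosed.inter isClosed_closure
  have hI : Nonempty I := ⟨(exists_forall_lt_of_mk_le hκ ∅ (by simp)).choose⟩
  obtain ⟨y, hy⟩ := IsCompact.nonempty_iInter_of_directed_nonempty_isCompact_isClosed _
    hanti.directed_ge
    (fun a => ⟨_, (hprop a).1, subset_closure (mem_iUnion.2 ⟨a, hmem (p a).1⟩)⟩)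
    (fun a => (hclosed a).isCompact) hclosed
  rw [mem_iInter] at hy
  obtain ⟨B, hBA, hB, hyB⟩ := (IsSaturated.iUnion fun b => hsatS (p b).1).exists_subset_mem_closure
    h𝒞 (hy hI.some).2
  choose r hr using fun b : B => mem_iUnion.1 (hBA b.2)
  obtain ⟨a, ha⟩ := exists_forall_lt_of_mk_le hκ (range r) (mk_range_le.trans hB)
  refine disjoint_left.1 (hprop a).2.2.2 (hy a).1 (closure_mono (fun b hb => ?_) hyB)
  exact mem_iUnion.2 ⟨⟨r ⟨b, hb⟩, ha _ (mem_range_self _)⟩, hr ⟨b, hb⟩⟩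

/-- The traces on `closure B` of closed `G_κ`-sets given by neighborhoods `U x` are determined by
the traces on `B` of these neighborhoods. -/
theorem exists_subset_closure_subset_iUnion {X ι : Type u} [TopologicalSpace X]
    {κ : Cardinal.{u}} (hκ : ℵ₀ ≤ κ) (hι : #ι ≤ κ) {G : X → Set X} {U : X → ι → Set X}
    (hxG : ∀ x, x ∈ G x) (hU : ∀ x i, IsOpen (U x i)) (hGU : ∀ x i, G x ⊆ U x i)
    (hUG : ∀ x, ⋂ i, closure (U x i) ⊆ G x) {B : Set X} (hB : #B ≤ κ) :
    ∃ S : Set X, #S ≤ 2 ^ κ ∧ closure B ⊆ ⋃ x ∈ S, G x := by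
  let tr : X → ι → Set B := fun x i => (↑) ⁻¹' U x i
  choose s hs using fun t : range tr => t.2
  refine ⟨range s, ?_, fun y hy => ?_⟩
  · refine mk_range_le.trans ((mk_set_le _).trans ?_)
    rw [← power_def, mk_set, ← power_mul]
    exact power_le_power_left two_ne_zero (Cardinal.mul_le_of_le hκ hB hι)
  · refine mem_biUnion (mem_range_self ⟨tr y, mem_range_self y⟩) ?_
    refine hUG _ (mem_iInter.2 fun i => ?_)
    have hi := congrFun (hs ⟨tr y, mem_range_self y⟩) i
    have hyU : y ∈ closure (U y i ∩ B) :=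
      (hU y i).inter_closure ⟨hGU y i (hxG y), hy⟩
    refine closure_mono ?_ hyU
    rintro b ⟨hbU, hbB⟩
    have : (⟨b, hbB⟩ : B) ∈ tr y i := hbU
    exact hi.symm.subset this

/-- Every cover of a compactum of weak tightness at most `κ` by closed `G_κ`-sets has a subcover
of size at most `2 ^ κ`. -/
theorem exists_subcover_of_closedGKappa_cover {X ι : Type u} [TopologicalSpace X] [CompactSpace X]
    [Nonempty X] {κ : Cardinal.{u}} (hκ : ℵ₀ ≤ κ) {𝒞 : Set (Set X)}
    (h𝒞 : IsWeakTightnessWitness X κ 𝒞) (hι : #ι ≤ κ) {G : X → Set X} {U : X → ι → Set X}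
    (hxG : ∀ x, x ∈ G x) (hU : ∀ x i, IsOpen (U x i)) (hGU : ∀ x i, G x ⊆ U x i)
    (hUG : ∀ x, ⋂ i, closure (U x i) ⊆ G x) :
    ∃ S : Set X, #S ≤ 2 ^ κ ∧ ⋃ x ∈ S, G x = Set.univ := by
  have h2 := aleph0_le_two_power hκ
  choose! S hS hBS using fun (B : Set X) (hB : #B ≤ κ) =>
    exists_subset_closure_subset_iUnion hκ hι hxG hU hGU hUG hB
  have hpick : ∀ l : List (X × ι), ∃ z : X, (∃ y, ∀ q ∈ l, y ∉ U q.1 q.2) →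
      ∀ q ∈ l, z ∉ U q.1 q.2 := by
    intro l
    by_cases h : ∃ y, ∀ q ∈ l, y ∉ U q.1 q.2
    · exact ⟨h.choose, fun _ => h.choose_spec⟩
    · exact ⟨Classical.arbitrary X, fun h' => absurd h' h⟩
  choose pick hpick using hpick
  let T : Set X → Set X := fun B => ⋃ B' : {B' : Set X // B' ⊆ B ∧ #B' ≤ κ}, S B'
  have hT : ∀ B : Set X, #B ≤ 2 ^ κ → #(T B) ≤ 2 ^ κ := fun B hB =>
    mk_iUnion_le_of_le h2 _ (mk_bounded_subset_le_two_power hκ hB) fun B' => hS B' B'.2.2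
  obtain ⟨A, hA, hAs, hAp⟩ := exists_isSaturated_closed_under hκ h𝒞
    (fun B => range fun l : List (T B × ι) => pick (l.map (Prod.map (↑) id))) fun B hB => by
      refine mk_range_le.trans ((mk_list_le_max _).trans (max_le h2 ?_))
      rw [mk_prod, lift_id, lift_id]
      exact Cardinal.mul_le_of_le h2 (hT B (hB.trans (cantor κ).le)) (hι.trans (cantor κ).le)
  refine ⟨T A, hT A hA, eq_univ_of_forall fun y => ?_⟩
  by_contra hy
  simp only [mem_iUnion, not_exists] at hy
  have hex : ∀ x : T A, ∃ i, y ∉ U x i := by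
    intro x
    by_contra! h
    exact hy x x.2 (hUG x (mem_iInter.2 fun i => subset_closure (h i)))
  choose i hi using hex
  have hcov : closure A ⊆ ⋃ x : T A, U x (i x) := by
    intro z hz
    obtain ⟨B, hBA, hB, hzB⟩ := hAs.exists_subset_mem_closure h𝒞 hz
    obtain ⟨x, hx, hzx⟩ := mem_iUnion₂.1 (hBS B hB hzB)
    exact mem_iUnion.2 ⟨⟨x, mem_iUnion.2 ⟨⟨B, hBA, hB⟩, hx⟩⟩, hGU _ _ hzx⟩
  obtain ⟨t, ht⟩ := isClosed_closure.isCompact.elim_finite_subcover _ (fun x : T A => hU x (i x))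
    hcov
  choose b hb using fun x : T A => mem_iUnion.1 x.2
  let B : Set X := ⋃ x : t, (b x : Set X)
  have hBA : B ⊆ A := iUnion_subset fun x => (b x).2.1
  have hB : #B ≤ κ := mk_iUnion_le_of_le hκ _ ((mk_lt_aleph0).le.trans hκ) fun x => (b x).2.2
  have hTB : ∀ x : t, (x : X) ∈ T B := fun x =>
    mem_iUnion.2 ⟨⟨b x, subset_iUnion (fun x : t => (b x : Set X)) x, (b x).2.2⟩, hb x⟩
  let l : List (T B × ι) := List.map (fun x : t => (⟨x, hTB x⟩, i x)) t.attach.toList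
  have hl : ∀ q, q ∈ l.map (Prod.map ((↑) : T B → X) id) ↔ ∃ x ∈ t, ((x : X), i x) = q := by
    intro q
    simp [l]
  have hzA : pick (l.map (Prod.map (↑) id)) ∈ A := hAp B hBA hB (mem_range_self l)
  have hz := hpick (l.map (Prod.map (↑) id)) ⟨y, fun q hq => by
    obtain ⟨x, -, rfl⟩ := (hl q).1 hq
    exact hi x⟩
  obtain ⟨x, hxt, hzx⟩ := mem_iUnion₂.1 (ht (subset_closure hzA))
  exact hz (x, i x) ((hl _).2 ⟨x, hxt, rfl⟩) hzx

/-- A homogeneous compactum of weak tightness at most `κ` has a dense subset of size at most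
`2 ^ κ`. -/
theorem exists_dense_of_homogeneous {X : Type u} [TopologicalSpace X] [CompactSpace X]
    [T2Space X] [Nonempty X] (hhom : ∀ x y : X, ∃ h : X ≃ₜ X, h x = y) {κ : Cardinal.{u}}
    (hκ : ℵ₀ ≤ κ) {𝒞 : Set (Set X)} (h𝒞 : IsWeakTightnessWitness X κ 𝒞) :
    ∃ D : Set X, Dense D ∧ #D ≤ 2 ^ κ := by
  obtain ⟨G, H, ⟨ι, U, hι, hU, hGU, hUG⟩, ⟨p, hp⟩, hH, hGH⟩ :=
    exists_isClosedGKappa_subset_closure hκ h𝒞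
  choose h hh using hhom p
  obtain ⟨S, hS, hcov⟩ := exists_subcover_of_closedGKappa_cover hκ h𝒞 hι
    (G := fun x => h x '' G) (U := fun x i => h x '' U i) (fun x => ⟨p, hp, hh x⟩)
    (fun x i => (h x).isOpenMap _ (hU i)) (fun x i => image_mono (hGU i)) fun x => by
      simp_rw [← (h x).image_closure]
      rw [← image_iInter (h x).bijective]
      exact image_mono hUG
  refine ⟨⋃ x : S, h x '' H, fun y => ?_, mk_iUnion_le_of_le (aleph0_le_two_power hκ) _ hS
    fun x => mk_image_le.trans hH⟩
  obtain ⟨x, hxS, hy⟩ := mem_iUnion₂.1 (hcov.symm ▸ mem_univ y : y ∈ ⋃ x ∈ S, h x '' G)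
  refine closure_mono (subset_iUnion (fun x : S => h x '' H) ⟨x, hxS⟩) ?_
  rw [← (h x).image_closure]
  exact image_mono hGH hy

theorem exists_localPiBase {X : Type u} [TopologicalSpace X] (p : X) :
    ∃ 𝒰 : Set (Set X), #𝒰 ≤ piCharacter X ∧ (∀ U ∈ 𝒰, IsOpen U ∧ U.Nonempty) ∧
      ∀ N ∈ nhds p, ∃ U ∈ 𝒰, U ⊆ N := by
  have hne : {c : Cardinal.{u} | ∃ 𝒰 : Set (Set X), #𝒰 = c ∧
      (∀ U ∈ 𝒰, IsOpen U ∧ U.Nonempty) ∧ ∀ N ∈ nhds p, ∃ U ∈ 𝒰, U ⊆ N}.Nonempty :=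
    ⟨_, {U | IsOpen U ∧ U.Nonempty}, rfl, fun _ hU => hU, fun N hN =>
      ⟨interior N, ⟨isOpen_interior, p, mem_interior_iff_mem_nhds.2 hN⟩, interior_subset⟩⟩
  obtain ⟨𝒰, hcard, h𝒰⟩ := csInf_mem hne
  refine ⟨𝒰, hcard.le.trans ?_, h𝒰⟩
  exact (le_ciSup (f := fun x : X => piCharacterAt x) bddAbove_of_small p).trans
    (le_max_right _ _)

/-- A homogeneous Hausdorff space has at most `#D ^ πχ(X)` points for `D` dense. -/
theorem mk_le_power_piCharacter {X : Type u} [TopologicalSpace X] [T2Space X]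
    (hhom : ∀ x y : X, ∃ h : X ≃ₜ X, h x = y) {D : Set X} (hD : Dense D) {c : Cardinal.{u}}
    (hc : c ≠ 0) (hDc : #D ≤ c) : #X ≤ c ^ piCharacter X := by
  rcases isEmpty_or_nonempty X with hX | ⟨⟨p⟩⟩
  · simp
  obtain ⟨𝒰, hcard, h𝒰, hp⟩ := exists_localPiBase p
  choose h hh using hhom p
  have key : ∀ (x : X) (U : 𝒰), ∃ d : D, (d : X) ∈ h x '' (U : Set X) := by
    intro x U
    obtain ⟨d, hdU, hdD⟩ := hD.inter_open_nonempty _ ((h x).isOpenMap _ (h𝒰 U U.2).1)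
      ((h𝒰 U U.2).2.image _)
    exact ⟨⟨d, hdD⟩, hdU⟩
  choose φ hφ using key
  have hinj : Function.Injective φ := by
    intro x y hxy
    by_contra hne
    obtain ⟨V, W, hV, hW, hxV, hyW, hVW⟩ := t2_separation hne
    have hN : h x ⁻¹' V ∩ h y ⁻¹' W ∈ nhds p := Filter.inter_mem
      ((hV.preimage (h x).continuous).mem_nhds (by simpa [hh] using hxV))
      ((hW.preimage (h y).continuous).mem_nhds (by simpa [hh] using hyW))
    obtain ⟨U, hU, hUN⟩ := hp _ hN
    have h₁ : (φ x ⟨U, hU⟩ : X) ∈ V :=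
      image_subset_iff.2 (hUN.trans inter_subset_left) (hφ x ⟨U, hU⟩)
    have h₂ : (φ y ⟨U, hU⟩ : X) ∈ W :=
      image_subset_iff.2 (hUN.trans inter_subset_right) (hφ y ⟨U, hU⟩)
    rw [hxy] at h₁
    exact disjoint_left.1 hVW h₁ h₂
  calc #X ≤ #(𝒰 → D) := mk_le_of_injective hinj
    _ = #D ^ #𝒰 := by rw [power_def]
    _ ≤ c ^ #𝒰 := power_le_power_right hDc
    _ ≤ c ^ piCharacter X := power_le_power_left hc hcard

/-- If `X` is a homogeneous compactum then `|X| ≤ 2^{wt(X)·πχ(X)}`. -/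
theorem card_le_of_homogeneous_compactum
    (X : Type u) [TopologicalSpace X] [CompactSpace X] [T2Space X]
    (hhom : ∀ x y : X, ∃ h : X ≃ₜ X, h x = y) :
    #X ≤ 2 ^ (weakTightness X * piCharacter X) := by
  rcases isEmpty_or_nonempty X with hX | hX
  · simp
  obtain ⟨hwt, 𝒞, h𝒞⟩ := isWeakTightnessWitness_weakTightness X
  have hπ : ℵ₀ ≤ piCharacter X := le_max_left _ _
  have hle : weakTightness X ≤ weakTightness X * piCharacter X :=
    Cardinal.le_mul_right (aleph0_pos.trans_le hπ).ne'
  have hle' : piCharacter X ≤ weakTightness X * piCharacter X :=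
    Cardinal.le_mul_left (aleph0_pos.trans_le hwt).ne'
  have hκ : ℵ₀ ≤ weakTightness X * piCharacter X := hwt.trans hle
  obtain ⟨D, hD, hDc⟩ := exists_dense_of_homogeneous hhom hκ (h𝒞.mono hle)
  have h2 : (2 : Cardinal.{u}) ^ (weakTightness X * piCharacter X) ≠ 0 :=
    (aleph0_pos.trans_le (aleph0_le_two_power hκ)).ne'
  calc #X ≤ (2 ^ (weakTightness X * piCharacter X)) ^ piCharacter X :=
        mk_le_power_piCharacter hhom hD h2 hDc
    _ ≤ (2 ^ (weakTightness X * piCharacter X)) ^ (weakTightness X * piCharacter X) :=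
        power_le_power_left h2 hle'
    _ = 2 ^ (weakTightness X * piCharacter X) := two_power_power_self hκ

end
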